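/- Let 1 ≤ p < ∞ and let a, b ∈ ℝ satisfy −1/p < a, b < 1−1/p and 0 ≤ b−a < 1/p. Then M(Λ_{p,t^{ap}}, Λ_{p,t^{bp}}) = M_{t^{b−a}}: a measurable x on (0,∞) satisfies x·y ∈ Λ_{p,t^{bp}} for every y ∈ Λ_{p,t^{ap}} if and only if sup_{t>0} t^{b−a} x*(t) < ∞. -/

import Mathlib

open MeasureTheory Set
open scoped ENNReal

/-- The decreasing rearrangement of `x` on the interval `I ⊆ (0,∞)`:
`x*(t) = inf {λ > 0 : m({s ∈ I : |x(s)| > λ}) ≤ t}` (with `inf ∅ = ∞`). -/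
noncomputable def rearr (I : Set ℝ) (x : ℝ → ℝ) (t : ℝ) : ℝ≥0∞ :=
  sInf (ENNReal.ofReal ''
    {a : ℝ | 0 < a ∧ volume {s : ℝ | s ∈ I ∧ a < |x s|} ≤ ENNReal.ofReal t})

/-- Membership in the Lorentz class `Λ_{p,w}`: `∫_0^∞ x*(t)^p w(t) dt < ∞`. -/
def lambdaMem (p : ℝ) (w : ℝ → ℝ) (x : ℝ → ℝ) : Prop :=
  (∫⁻ t in Ioi (0:ℝ), rearr (Ioi 0) x t ^ p * ENNReal.ofReal (w t)) < ⊤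

lemma rearr_le {I : Set ℝ} {x : ℝ → ℝ} {t l : ℝ} (hl : 0 < l)
    (h : volume {s : ℝ | s ∈ I ∧ l < |x s|} ≤ ENNReal.ofReal t) :
    rearr I x t ≤ ENNReal.ofReal l :=
  sInf_le ⟨l, ⟨hl, h⟩, rfl⟩

lemma le_rearr {I : Set ℝ} {x : ℝ → ℝ} {t h : ℝ}
    (H : ∀ l, 0 < l → l < h → ENNReal.ofReal t < volume {s : ℝ | s ∈ I ∧ l < |x s|}) :
    ENNReal.ofReal h ≤ rearr I x t := by
  refine le_sInf ?_
  rintro _ ⟨l, ⟨hl, hv⟩, rfl⟩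
  by_contra! hlt
  exact absurd hv (not_le.2 (H l hl (ENNReal.ofReal_lt_ofReal_iff'.1 hlt).1))

lemma rearr_mul_le {I : Set ℝ} {x y : ℝ → ℝ} {t l : ℝ} (ht : 0 ≤ t) (hl : 0 < l)
    (h : rearr I x (t / 2) < ENNReal.ofReal l) :
    rearr I (fun s => x s * y s) t ≤ ENNReal.ofReal l * rearr I y (t / 2) := by
  obtain ⟨_, ⟨k, ⟨hk, hkv⟩, rfl⟩, hkl⟩ := sInf_lt_iff.1 h
  have hkl' : k < l := (ENNReal.ofReal_lt_ofReal_iff'.1 hkl).1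
  have hl0 : ENNReal.ofReal l ≠ 0 := by simpa using hl
  rw [mul_comm, ← ENNReal.div_le_iff hl0 ENNReal.ofReal_ne_top]
  refine le_sInf ?_
  rintro _ ⟨m, ⟨hm, hmv⟩, rfl⟩
  rw [ENNReal.div_le_iff hl0 ENNReal.ofReal_ne_top, ← ENNReal.ofReal_mul hm.le]
  refine rearr_le (by positivity) ?_
  have hsub : {s : ℝ | s ∈ I ∧ m * l < |x s * y s|} ⊆
      {s : ℝ | s ∈ I ∧ k < |x s|} ∪ {s : ℝ | s ∈ I ∧ m < |y s|} := by
    rintro s ⟨hs, hlt⟩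
    by_contra hcon
    simp only [mem_union, mem_ofPred_eq, hs, true_and, not_or, not_lt] at hcon
    rw [abs_mul] at hlt
    nlinarith [mul_le_mul hcon.1 hcon.2 (abs_nonneg _) hk.le]
  calc _ ≤ _ := measure_mono hsub
    _ ≤ _ := measure_union_le _ _
    _ ≤ ENNReal.ofReal (t / 2) + ENNReal.ofReal (t / 2) := add_le_add hkv hmv
    _ = ENNReal.ofReal t := by
      rw [← ENNReal.ofReal_add (by positivity) (by positivity), add_halves]

lemma lintegral_Ioi_comp_half (f : ℝ → ℝ≥0∞) :
    ∫⁻ t in Ioi (0:ℝ), f (t / 2) = 2 * ∫⁻ t in Ioi (0:ℝ), f t := by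
  have himg : (fun t : ℝ => 2 * t) '' Ioi 0 = Ioi 0 := by
    rw [image_mul_left_Ioi (by norm_num : (0:ℝ) < 2), mul_zero]
  have := lintegral_image_eq_lintegral_abs_deriv_mul (s := Ioi (0:ℝ)) (f := fun t : ℝ => 2 * t)
    (f' := fun _ => 2) measurableSet_Ioi
    (fun t _ => by simpa using ((hasDerivAt_id t).const_mul (2:ℝ)).hasDerivWithinAt)
    (fun u _ v _ h => by simpa using h) (fun t => f (t / 2))
  rw [himg] at this
  rw [this, ← lintegral_const_mul' _ _ (by norm_num)]
  simp

lemma lintegral_Ioo_rpow {r T : ℝ} (hr : -1 < r) (hT : 0 ≤ T) :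
    ∫⁻ t in Ioo (0:ℝ) T, ENNReal.ofReal (t ^ r) = ENNReal.ofReal (T ^ (r + 1) / (r + 1)) := by
  have hint : IntegrableOn (fun t : ℝ => t ^ r) (Ioc 0 T) :=
    (intervalIntegrable_iff_integrableOn_Ioc_of_le hT).1
      (intervalIntegral.intervalIntegrable_rpow' hr)
  rw [setLIntegral_congr Ioo_ae_eq_Ioc, ← ofReal_integral_eq_lintegral_ofReal hint,
    ← intervalIntegral.integral_of_le hT, integral_rpow (Or.inl hr),
    Real.zero_rpow (by linarith), sub_zero]
  filter_upwards [ae_restrict_mem measurableSet_Ioc] with t ht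
  exact Real.rpow_nonneg ht.1.le _

lemma lambdaMem_mul_of_marcinkiewicz {p a b : ℝ} (hp : 1 ≤ p) {x y : ℝ → ℝ}
    (hx : (⨆ t ∈ Ioi (0:ℝ), ENNReal.ofReal (t ^ (b - a)) * rearr (Ioi 0) x t) < ⊤)
    (hy : lambdaMem p (fun t => t ^ (a * p)) y) :
    lambdaMem p (fun t => t ^ (b * p)) (fun t => x t * y t) := by
  obtain ⟨C, hC, hxC⟩ : ∃ C : ℝ, 0 < C ∧ ∀ t, 0 < t →
      ENNReal.ofReal (t ^ (b - a)) * rearr (Ioi 0) x t < ENNReal.ofReal C := by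
    obtain ⟨C, hC, hC'⟩ := ENNReal.lt_iff_exists_real_btwn.1 hx
    have hlt : ∀ t, 0 < t →
        ENNReal.ofReal (t ^ (b - a)) * rearr (Ioi 0) x t < ENNReal.ofReal C := fun t ht =>
      lt_of_le_of_lt (le_iSup₂ (f := fun (t : ℝ) (_ : t ∈ Ioi (0:ℝ)) =>
        ENNReal.ofReal (t ^ (b - a)) * rearr (Ioi 0) x t) t ht) hC'.1
    exact ⟨C, ENNReal.ofReal_pos.1 (lt_of_le_of_lt zero_le (hlt 1 one_pos)), hlt⟩
  set K : ℝ≥0∞ := ENNReal.ofReal (C ^ p * 2 ^ (b * p))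
  have key : ∀ t ∈ Ioi (0:ℝ),
      rearr (Ioi 0) (fun t => x t * y t) t ^ p * ENNReal.ofReal (t ^ (b * p)) ≤
      K * (rearr (Ioi 0) y (t / 2) ^ p * ENNReal.ofReal ((t / 2) ^ (a * p))) := by
    intro t ht
    rw [mem_Ioi] at ht
    have h2 : 0 < t / 2 := by positivity
    have hw : 0 < (t / 2) ^ (b - a) := Real.rpow_pos_of_pos h2 _
    have h1 : rearr (Ioi 0) x (t / 2) < ENNReal.ofReal (C / (t / 2) ^ (b - a)) := by
      rw [ENNReal.ofReal_div_of_pos hw, ENNReal.lt_div_iff_mul_lt (Or.inl (ENNReal.ofReal_pos.2 hw).ne')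
        (Or.inl ENNReal.ofReal_ne_top), mul_comm]
      exact hxC _ h2
    have h3 := rearr_mul_le (y := y) ht.le (by positivity) h1
    have h4 : (C / (t / 2) ^ (b - a)) ^ p * t ^ (b * p) =
        C ^ p * 2 ^ (b * p) * (t / 2) ^ (a * p) := by
      rw [Real.div_rpow hC.le hw.le, ← Real.rpow_mul h2.le]
      nth_rewrite 2 [show t = 2 * (t / 2) by ring]
      rw [Real.mul_rpow (by norm_num) h2.le,
        show b * p = (b - a) * p + a * p by ring, Real.rpow_add h2]
      have : (t / 2) ^ ((b - a) * p) ≠ 0 := (Real.rpow_pos_of_pos h2 _).ne'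
      field_simp
    calc _ ≤ (ENNReal.ofReal (C / (t / 2) ^ (b - a)) * rearr (Ioi 0) y (t / 2)) ^ p *
          ENNReal.ofReal (t ^ (b * p)) := by gcongr
      _ = ENNReal.ofReal ((C / (t / 2) ^ (b - a)) ^ p * t ^ (b * p)) *
          rearr (Ioi 0) y (t / 2) ^ p := by
        rw [ENNReal.mul_rpow_of_nonneg _ _ (by linarith),
          ENNReal.ofReal_rpow_of_nonneg (by positivity) (by linarith),
          ENNReal.ofReal_mul (by positivity)]
        ring
      _ = _ := by
        rw [h4, ENNReal.ofReal_mul (by positivity)]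
        ring
  refine lt_of_le_of_lt (setLIntegral_mono' measurableSet_Ioi key) ?_
  rw [lintegral_const_mul' _ _ ENNReal.ofReal_ne_top, lintegral_Ioi_comp_half
    (fun t => rearr (Ioi 0) y t ^ p * ENNReal.ofReal (t ^ (a * p)))]
  exact ENNReal.mul_lt_top ENNReal.ofReal_lt_top (ENNReal.mul_lt_top (by norm_num) hy)

lemma volume_lt_iSup_indicator_le {B : ℕ → Set ℝ} {τ h : ℕ → ℝ} {t l : ℝ} (ht : 0 ≤ t)
    (hB : ∀ n, volume (B n) = ENNReal.ofReal (τ n))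
    (H : ∀ n, l < h n → 2 ^ (n + 1) * τ n ≤ t) :
    volume {s | ENNReal.ofReal l < ⨆ n, (B n).indicator (fun _ => ENNReal.ofReal (h n)) s} ≤
      ENNReal.ofReal t := by
  have hsub : {s | ENNReal.ofReal l < ⨆ n, (B n).indicator (fun _ => ENNReal.ofReal (h n)) s} ⊆
      ⋃ n, {s | s ∈ B n ∧ l < h n} := by
    intro s hs
    rw [mem_ofPred_eq, lt_iSup_iff] at hs
    obtain ⟨n, hn⟩ := hs
    refine mem_iUnion.2 ⟨n, ?_⟩
    by_cases hsB : s ∈ B n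
    · rw [indicator_of_mem hsB] at hn
      exact ⟨hsB, (ENNReal.ofReal_lt_ofReal_iff'.1 hn).1⟩
    · rw [indicator_of_notMem hsB] at hn
      exact absurd hn not_lt_zero
  have hle : ∀ n, volume {s | s ∈ B n ∧ l < h n} ≤ ENNReal.ofReal (t / 2 / 2 ^ n) := by
    intro n
    by_cases hn : l < h n
    · simp only [hn, and_true, ofPred_mem_eq, hB]
      refine ENNReal.ofReal_le_ofReal ?_
      rw [div_div, le_div_iff₀ (by positivity), ← pow_succ', mul_comm]
      exact H n hn
    · simp [hn]
  calc _ ≤ _ := measure_mono hsub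
    _ ≤ _ := measure_iUnion_le _
    _ ≤ ∑' n : ℕ, ENNReal.ofReal (t / 2 / 2 ^ n) := ENNReal.tsum_le_tsum hle
    _ = ENNReal.ofReal t := by
      rw [← ENNReal.ofReal_tsum_of_nonneg (fun n => by positivity) (summable_geometric_two' t),
        tsum_geometric_two' t]

lemma rearr_toReal_iSup_indicator_rpow_le {B : ℕ → Set ℝ} {τ h : ℕ → ℝ} {I : Set ℝ} {t p : ℝ}
    (hp : 0 < p) (ht : 0 ≤ t) (hB : ∀ n, volume (B n) = ENNReal.ofReal (τ n)) :
    rearr I (fun s => (⨆ n, (B n).indicator (fun _ => ENNReal.ofReal (h n)) s).toReal) t ^ p ≤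
      ∑' n, (Iio (2 ^ (n + 1) * τ n)).indicator (fun _ => ENNReal.ofReal (h n) ^ p) t := by
  set g : ℕ → ℝ≥0∞ := fun n => (Iio (2 ^ (n + 1) * τ n)).indicator (fun _ => ENNReal.ofReal (h n)) t
  have hmain : rearr I
      (fun s => (⨆ n, (B n).indicator (fun _ => ENNReal.ofReal (h n)) s).toReal) t ≤ ⨆ n, g n := by
    refine le_of_forall_gt fun c hc => ?_
    obtain ⟨l, hl0, hl1, hl2⟩ := ENNReal.lt_iff_exists_real_btwn.1 hc
    have hlpos : 0 < l := ENNReal.ofReal_pos.1 (lt_of_le_of_lt zero_le hl1)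
    refine lt_of_le_of_lt (rearr_le hlpos ?_) hl2
    refine le_trans (measure_mono ?_)
      (volume_lt_iSup_indicator_le (h := h) (l := l) ht hB fun n hn => ?_)
    · rintro s ⟨-, hs⟩
      rw [abs_of_nonneg ENNReal.toReal_nonneg] at hs
      exact (ENNReal.ofReal_lt_iff_lt_toReal hl0
        (fun htop => by simp [htop] at hs; linarith)).2 hs
    · by_contra! hcon
      have h1 : g n = ENNReal.ofReal (h n) := indicator_of_mem (mem_Iio.2 hcon) _
      have h2 := (le_iSup g n).trans_lt hl1
      rw [h1, ENNReal.ofReal_lt_ofReal_iff hlpos] at h2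
      linarith
  calc _ ≤ (⨆ n, g n) ^ p := by gcongr
    _ = ⨆ n, g n ^ p := (ENNReal.orderIsoRpow p hp).map_iSup g
    _ ≤ ∑' n, g n ^ p := iSup_le fun n => ENNReal.le_tsum n
    _ = _ := by
      congr 1 with n
      simp only [g, indicator]
      split_ifs <;> simp [hp]

lemma exists_finite_superlevel {x : ℝ → ℝ} (hx : Measurable x) {d : ℝ} (hd : 0 ≤ d)
    (hsup : ¬ (⨆ t ∈ Ioi (0:ℝ), ENNReal.ofReal (t ^ d) * rearr (Ioi 0) x t) < ⊤)
    {N : ℝ} (hN : 0 < N) :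
    ∃ (B : Set ℝ) (τ l : ℝ), MeasurableSet B ∧ 0 < τ ∧ 0 < l ∧ volume B = ENNReal.ofReal τ ∧
      (∀ s ∈ B, 0 < s ∧ l < |x s|) ∧ N ≤ l * τ ^ d := by
  have h1 : ENNReal.ofReal N <
      ⨆ t ∈ Ioi (0:ℝ), ENNReal.ofReal (t ^ d) * rearr (Ioi 0) x t := by
    rw [not_lt_top_iff.1 hsup]
    exact ENNReal.ofReal_lt_top
  simp only [lt_iSup_iff] at h1
  obtain ⟨t, ht, hNt⟩ := h1
  rw [mem_Ioi] at ht
  have htd : 0 < t ^ d := Real.rpow_pos_of_pos ht _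
  have hl : 0 < N / t ^ d := by positivity
  have h2 : ENNReal.ofReal t < volume {s : ℝ | s ∈ Ioi (0:ℝ) ∧ N / t ^ d < |x s|} := by
    by_contra! hcon
    have h3 := rearr_le hl hcon
    have h4 : ENNReal.ofReal (t ^ d) * rearr (Ioi 0) x t ≤ ENNReal.ofReal N := by
      calc _ ≤ ENNReal.ofReal (t ^ d) * ENNReal.ofReal (N / t ^ d) := by gcongr
        _ = ENNReal.ofReal N := by
          rw [← ENNReal.ofReal_mul htd.le, mul_div_cancel₀ _ htd.ne']
    exact absurd hNt (not_lt.2 h4)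
  have hmeas : MeasurableSet {s : ℝ | s ∈ Ioi (0:ℝ) ∧ N / t ^ d < |x s|} :=
    measurableSet_Ioi.inter (measurableSet_lt measurable_const hx.abs)
  obtain ⟨B, hBsub, hBc, hBt⟩ := hmeas.exists_lt_isCompact h2
  have hfin : volume B ≠ ⊤ := hBc.measure_lt_top.ne
  have htau : t < (volume B).toReal := (ENNReal.ofReal_lt_iff_lt_toReal ht.le hfin).1 hBt
  refine ⟨B, (volume B).toReal, N / t ^ d, hBc.measurableSet, ht.trans htau, hl,
    (ENNReal.ofReal_toReal hfin).symm, fun s hs => hBsub hs, ?_⟩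
  rw [div_mul_eq_mul_div, le_div_iff₀ htd]
  gcongr

lemma marcinkiewicz_of_forall_lambdaMem_mul {p a b : ℝ} (hp : 1 ≤ p) (ha : -(1/p) < a)
    (hb : -(1/p) < b) (hba : 0 ≤ b - a) {x : ℝ → ℝ} (hx : Measurable x)
    (H : ∀ y : ℝ → ℝ, Measurable y → lambdaMem p (fun t => t ^ (a * p)) y →
      lambdaMem p (fun t => t ^ (b * p)) (fun t => x t * y t)) :
    (⨆ t ∈ Ioi (0:ℝ), ENNReal.ofReal (t ^ (b - a)) * rearr (Ioi 0) x t) < ⊤ := by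
  by_contra hsup
  have hp0 : 0 < p := by linarith
  set α : ℝ := a + 1 / p with hα
  have hα0 : 0 < α := by linarith
  have hαp : a * p + 1 = α * p := by rw [hα]; field_simp
  have hβ0 : 0 < b + 1 / p := by linarith
  have hβp : b * p + 1 = (b + 1 / p) * p := by field_simp
  have hβp0 : 0 < b * p + 1 := by rw [hβp]; positivity
  have hαp0 : 0 < a * p + 1 := by rw [hαp]; positivity
  set q : ℕ → ℝ := fun n => 2 ^ (n + 1) with hq
  have hq0 : ∀ n, 0 < q n := fun n => by positivity
  have hq1 : ∀ n, 1 ≤ q n := fun n => one_le_pow₀ (by norm_num)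
  have hex := fun n => exists_finite_superlevel hx hba hsup
    (Real.rpow_pos_of_pos (hq0 n) (α + 2))
  choose B τ l hBm hτ hl hBτ hBx hN using hex
  set h : ℕ → ℝ := fun n => q n ^ (-(α + 1)) * τ n ^ (-α) with hh
  have hh0 : ∀ n, 0 < h n := fun n =>
    mul_pos (Real.rpow_pos_of_pos (hq0 n) _) (Real.rpow_pos_of_pos (hτ n) _)
  set Y : ℝ → ℝ≥0∞ := fun s => ⨆ n, (B n).indicator (fun _ => ENNReal.ofReal (h n)) s with hY
  have hYm : Measurable Y := Measurable.iSup fun n => measurable_const.indicator (hBm n)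
  have hYnull : volume {s | Y s = ⊤} = 0 := by
    refine le_antisymm (ENNReal.le_of_forall_pos_le_add fun ε hε _ => ?_) zero_le
    have hε' : (0:ℝ) < ε := hε
    rw [zero_add, ← ENNReal.ofReal_coe_nnreal]
    refine le_trans (measure_mono ?_) (volume_lt_iSup_indicator_le (h := h)
      (l := (ε:ℝ) ^ (-α)) hε'.le hBτ fun n hn => ?_)
    · intro s hs
      change ENNReal.ofReal _ < Y s
      rw [show Y s = ⊤ from hs]
      exact ENNReal.ofReal_lt_top
    · have h1 : h n ≤ (q n * τ n) ^ (-α) := by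
        rw [Real.mul_rpow (hq0 n).le (hτ n).le]
        have := (Real.rpow_pos_of_pos (hτ n) (-α)).le
        refine mul_le_mul_of_nonneg_right ?_ this
        exact Real.rpow_le_rpow_of_exponent_le (hq1 n) (by linarith)
      by_contra! hcon
      have h2 := Real.rpow_le_rpow_of_nonpos hε' hcon.le (by linarith : -α ≤ 0)
      linarith
  have hyΛ : lambdaMem p (fun t => t ^ (a * p)) (fun s => (Y s).toReal) := by
    have hterm : ∀ n, ∫⁻ t in Ioi (0:ℝ), (Iio (q n * τ n)).indicator
        (fun _ => ENNReal.ofReal (h n) ^ p) t * ENNReal.ofReal (t ^ (a * p)) ≤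
        ENNReal.ofReal (1 / (a * p + 1) / 2 / 2 ^ n) := by
      intro n
      have h1 : ∀ t : ℝ, (Iio (q n * τ n)).indicator
          (fun _ => ENNReal.ofReal (h n) ^ p) t * ENNReal.ofReal (t ^ (a * p)) =
          (Iio (q n * τ n)).indicator
          (fun t => ENNReal.ofReal (h n ^ p) * ENNReal.ofReal (t ^ (a * p))) t := by
        intro t
        rw [ENNReal.ofReal_rpow_of_nonneg (hh0 n).le hp0.le]
        simp only [indicator]
        split_ifs <;> simp
      simp_rw [h1]
      rw [setLIntegral_indicator measurableSet_Iio, Iio_inter_Ioi,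
        lintegral_const_mul' _ _ ENNReal.ofReal_ne_top,
        lintegral_Ioo_rpow (by linarith) (mul_pos (hq0 n) (hτ n)).le,
        ← ENNReal.ofReal_mul (Real.rpow_nonneg (hh0 n).le _)]
      refine ENNReal.ofReal_le_ofReal ?_
      have h2 : h n ^ p * (q n * τ n) ^ (a * p + 1) = q n ^ (-p) := by
        rw [hh, hαp, Real.mul_rpow (Real.rpow_nonneg (hq0 n).le _) (Real.rpow_nonneg (hτ n).le _),
          Real.mul_rpow (hq0 n).le (hτ n).le, ← Real.rpow_mul (hq0 n).le,
          ← Real.rpow_mul (hτ n).le, mul_mul_mul_comm, ← Real.rpow_add (hq0 n),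
          ← Real.rpow_add (hτ n)]
        ring_nf
        simp
      have h3 : q n ^ (-p) ≤ (q n)⁻¹ := by
        rw [← Real.rpow_neg_one]
        exact Real.rpow_le_rpow_of_exponent_le (hq1 n) (by linarith)
      rw [← mul_div_assoc, h2, div_div, div_div, div_le_div_iff₀ hαp0 (by positivity)]
      have h4 : (q n)⁻¹ * (2 * 2 ^ n) = 1 := by
        rw [← pow_succ', inv_mul_cancel₀ (hq0 n).ne']
      calc _ ≤ (q n)⁻¹ * ((a * p + 1) * (2 * 2 ^ n)) := by gcongr
        _ = (a * p + 1) * ((q n)⁻¹ * (2 * 2 ^ n)) := by ring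
        _ = _ := by rw [h4, mul_one, one_mul]
    have hle : ∫⁻ t in Ioi (0:ℝ), rearr (Ioi 0) (fun s => (Y s).toReal) t ^ p *
        ENNReal.ofReal (t ^ (a * p)) ≤ ENNReal.ofReal (1 / (a * p + 1)) := by
      calc _ ≤ ∫⁻ t in Ioi (0:ℝ), ∑' n, (Iio (q n * τ n)).indicator
            (fun _ => ENNReal.ofReal (h n) ^ p) t * ENNReal.ofReal (t ^ (a * p)) := by
            refine setLIntegral_mono' measurableSet_Ioi fun t ht => ?_
            rw [ENNReal.tsum_mul_right]
            gcongr
            exact rearr_toReal_iSup_indicator_rpow_le hp0 (mem_Ioi.1 ht).le hBτ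
        _ = ∑' n, ∫⁻ t in Ioi (0:ℝ), (Iio (q n * τ n)).indicator
            (fun _ => ENNReal.ofReal (h n) ^ p) t * ENNReal.ofReal (t ^ (a * p)) := by
            refine lintegral_tsum fun n => Measurable.aemeasurable ?_
            exact (measurable_const.indicator measurableSet_Iio).mul (by fun_prop)
        _ ≤ ∑' n : ℕ, ENNReal.ofReal (1 / (a * p + 1) / 2 / 2 ^ n) := ENNReal.tsum_le_tsum hterm
        _ = _ := by
          rw [← ENNReal.ofReal_tsum_of_nonneg (fun n => by positivity) (summable_geometric_two' _),
            tsum_geometric_two']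
    exact hle.trans_lt ENNReal.ofReal_lt_top
  have hJ := H _ hYm.ennreal_toReal hyΛ
  unfold lambdaMem at hJ
  have hlow : ∀ n, ENNReal.ofReal (q n / (b * p + 1)) ≤
      ∫⁻ t in Ioi (0:ℝ), rearr (Ioi 0) (fun s => x s * (Y s).toReal) t ^ p *
        ENNReal.ofReal (t ^ (b * p)) := by
    intro n
    have hlh : 0 < l n * h n := mul_pos (hl n) (hh0 n)
    have hrear : ∀ t ∈ Ioo 0 (τ n), ENNReal.ofReal (l n * h n) ≤
        rearr (Ioi 0) (fun s => x s * (Y s).toReal) t := by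
      intro t ht
      refine le_rearr fun k hk hkl => ?_
      calc ENNReal.ofReal t < ENNReal.ofReal (τ n) :=
            (ENNReal.ofReal_lt_ofReal_iff (hτ n)).2 ht.2
        _ = volume (B n \ {s | Y s = ⊤}) := by rw [measure_sdiff_null hYnull, hBτ]
        _ ≤ _ := by
          refine measure_mono ?_
          rintro s ⟨hs, hsY⟩
          obtain ⟨hs0, hsl⟩ := hBx n s hs
          refine ⟨hs0, ?_⟩
          have h1 : ENNReal.ofReal (h n) ≤ Y s := by
            have := le_iSup (fun n => (B n).indicator (fun _ => ENNReal.ofReal (h n)) s) n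
            rwa [indicator_of_mem hs] at this
          have h2 : h n ≤ (Y s).toReal := (ENNReal.ofReal_le_iff_le_toReal hsY).1 h1
          rw [abs_mul, abs_of_nonneg (ENNReal.toReal_nonneg (a := Y s))]
          exact hkl.trans_le (mul_le_mul hsl.le h2 (hh0 n).le (abs_nonneg _))
    have hval : q n ≤ (l n * h n) ^ p * τ n ^ (b * p + 1) := by
      have h1 : (l n * h n) ^ p * τ n ^ (b * p + 1) =
          (l n * τ n ^ (b - a) * q n ^ (-(α + 1))) ^ p := by
        rw [hβp, Real.rpow_mul (hτ n).le, ← Real.mul_rpow hlh.le (Real.rpow_nonneg (hτ n).le _)]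
        congr 1
        rw [show b - a = -α + (b + 1 / p) by rw [hα]; ring, Real.rpow_add (hτ n) (-α)]
        simp only [hh]
        ring
      have h2 : q n ≤ l n * τ n ^ (b - a) * q n ^ (-(α + 1)) := by
        calc q n = q n ^ (α + 2) * q n ^ (-(α + 1)) := by
              rw [← Real.rpow_add (hq0 n), show α + 2 + -(α + 1) = 1 by ring, Real.rpow_one]
          _ ≤ _ := mul_le_mul_of_nonneg_right (hN n) (Real.rpow_nonneg (hq0 n).le _)
      rw [h1]
      calc q n = q n ^ (1:ℝ) := (Real.rpow_one _).symm
        _ ≤ q n ^ p := Real.rpow_le_rpow_of_exponent_le (hq1 n) hp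
        _ ≤ _ := Real.rpow_le_rpow (hq0 n).le h2 hp0.le
    calc _ ≤ ENNReal.ofReal ((l n * h n) ^ p * (τ n ^ (b * p + 1) / (b * p + 1))) := by
          rw [← mul_div_assoc]
          gcongr
      _ = ∫⁻ t in Ioo 0 (τ n), ENNReal.ofReal (l n * h n) ^ p * ENNReal.ofReal (t ^ (b * p)) := by
          rw [ENNReal.ofReal_rpow_of_nonneg hlh.le hp0.le,
            lintegral_const_mul' _ _ ENNReal.ofReal_ne_top,
            lintegral_Ioo_rpow (by linarith) (hτ n).le,
            ENNReal.ofReal_mul (Real.rpow_nonneg hlh.le _)]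
      _ ≤ ∫⁻ t in Ioo 0 (τ n), rearr (Ioi 0) (fun s => x s * (Y s).toReal) t ^ p *
          ENNReal.ofReal (t ^ (b * p)) := by
          refine setLIntegral_mono' measurableSet_Ioo fun t ht => ?_
          gcongr
          exact hrear t ht
      _ ≤ _ := lintegral_mono_set Ioo_subset_Ioi_self
  obtain ⟨n, hn⟩ := pow_unbounded_of_one_lt
    ((∫⁻ t in Ioi (0:ℝ), rearr (Ioi 0) (fun s => x s * (Y s).toReal) t ^ p *
        ENNReal.ofReal (t ^ (b * p))).toReal * (b * p + 1)) (one_lt_two : (1:ℝ) < 2)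
  have h1 := (ENNReal.ofReal_le_iff_le_toReal hJ.ne).1 (hlow n)
  rw [div_le_iff₀ hβp0] at h1
  have h2 : q n = 2 * 2 ^ n := pow_succ' _ _
  have h3 : (0:ℝ) < 2 ^ n := by positivity
  linarith

/-- for `1 ≤ p < ∞`, `−1/p < a, b < 1−1/p` and `0 ≤ b−a < 1/p`, one has
`M(Λ_{p,t^{ap}}, Λ_{p,t^{bp}}) = M_{t^{b−a}}` (a Marcinkiewicz class):
`x` is a multiplier iff `sup_{t>0} t^{b−a} x*(t) < ∞`. -/
theorem stmt15 (p : ℝ) (hp : 1 ≤ p)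
    (a b : ℝ) (ha₁ : -(1/p) < a) (ha₂ : a < 1 - 1/p)
    (hb₁ : -(1/p) < b) (hb₂ : b < 1 - 1/p)
    (hba₁ : 0 ≤ b - a) (hba₂ : b - a < 1/p)
    (x : ℝ → ℝ) (hx : Measurable x) :
    (∀ y : ℝ → ℝ, Measurable y →
        lambdaMem p (fun t => t ^ (a * p)) y →
        lambdaMem p (fun t => t ^ (b * p)) (fun t => x t * y t)) ↔
      (⨆ t ∈ Ioi (0:ℝ), ENNReal.ofReal (t ^ (b - a)) * rearr (Ioi 0) x t) < ⊤ := by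
  exact ⟨marcinkiewicz_of_forall_lambdaMem_mul hp ha₁ hb₁ hba₁ hx,
    fun hsup y _ hy => lambdaMem_mul_of_marcinkiewicz hp hsup hy⟩
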